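/- For every positive integer i and every f ∈ P, one has T_i(R_{i+1} f) = R_i(T_{i+1} f) + R_{i+1}(T_i f). -/

import Mathlib

/-!
Statement 2. With `P = ℤ[x₁, x₂, …]` (variables indexed by positive integers),
the Bergeron–Sottile maps `R_i` and the quasisymmetric divided differences `T_i`
(characterized by `x_i · (T_i f) = R_{i+1} f − R_i f`) satisfy
`T_i (R_{i+1} f) = R_i (T_{i+1} f) + R_{i+1} (T_i f)` for every `i ≥ 1` and `f ∈ P`.
-/

/-- The polynomial ring `ℤ[x₁, x₂, …]` with variables indexed by the positive integers. -/
abbrev PolyP : Type := MvPolynomial ℕ+ ℤ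

/-- The Bergeron–Sottile map `R_i : P → P`,
`f(x₁, x₂, …) ↦ f(x₁, …, x_{i−1}, 0, x_i, x_{i+1}, …)`. -/
noncomputable def Rop (i : ℕ+) : PolyP →ₐ[ℤ] PolyP :=
  MvPolynomial.aeval (fun j : ℕ+ =>
    if j < i then MvPolynomial.X j
    else if j = i then 0
    else MvPolynomial.X (j - 1))

theorem Rop_X_of_lt {i j : ℕ+} (h : j < i) :
    Rop i (MvPolynomial.X j) = MvPolynomial.X j := by
  simp [Rop, h]

theorem Rop_X_self (i : ℕ+) : Rop i (MvPolynomial.X i) = 0 := by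
  simp [Rop]

theorem Rop_X_of_gt {i j : ℕ+} (h : i < j) :
    Rop i (MvPolynomial.X j) = MvPolynomial.X (j - 1) := by
  simp [Rop, h.not_gt, h.ne']

theorem Rop_X_add_one {i j : ℕ+} (h : i ≤ j) :
    Rop i (MvPolynomial.X (j + 1)) = MvPolynomial.X j := by
  rw [Rop_X_of_gt (PNat.lt_add_one_iff.2 h), PNat.add_sub]

/-- The commutation relation `R_i R_{j+1} = R_j R_i` for `i < j`. -/
theorem Rop_Rop_add_one {i j : ℕ+} (hij : i < j) (f : PolyP) :
    Rop i (Rop (j + 1) f) = Rop j (Rop i f) := by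
  suffices h : (Rop i).comp (Rop (j + 1)) = (Rop j).comp (Rop i) from
    DFunLike.congr_fun h f
  refine MvPolynomial.algHom_ext fun k => ?_
  simp only [AlgHom.comp_apply]
  rcases lt_trichotomy k i with hk | rfl | hk
  · rw [Rop_X_of_lt (hk.trans (hij.trans (PNat.lt_add_right j 1))), Rop_X_of_lt hk,
      Rop_X_of_lt (hk.trans hij)]
  · rw [Rop_X_of_lt (hij.trans (PNat.lt_add_right j 1)), Rop_X_self, map_zero]
  · obtain ⟨m, rfl⟩ := PNat.exists_eq_succ_of_ne_one (one_lt_of_gt hk).ne'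
    have him : i ≤ m := PNat.lt_add_one_iff.1 hk
    rw [Rop_X_add_one him]
    rcases lt_trichotomy m j with hm | rfl | hm
    · rw [Rop_X_of_lt (add_lt_add_left hm 1), Rop_X_of_lt hm, Rop_X_add_one him]
    · rw [Rop_X_self, Rop_X_self, map_zero]
    · obtain ⟨n, rfl⟩ := PNat.exists_eq_succ_of_ne_one (one_lt_of_gt hm).ne'
      have hjn : j ≤ n := PNat.lt_add_one_iff.1 hm
      rw [Rop_X_add_one hm, Rop_X_add_one hjn, Rop_X_add_one (hij.le.trans hjn)]

theorem stmt2 (T : ℕ+ → (PolyP →ₗ[ℤ] PolyP))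
    (hT : ∀ (i : ℕ+) (f : PolyP),
      (MvPolynomial.X i : PolyP) * T i f = Rop (i + 1) f - Rop i f)
    (i : ℕ+) (f : PolyP) :
    T i (Rop (i + 1) f) = Rop i (T (i + 1) f) + Rop (i + 1) (T i f) := by
  apply mul_left_cancel₀ (MvPolynomial.X_ne_zero i)
  have h₁ := congrArg (Rop i) (hT (i + 1) f)
  have h₂ := congrArg (Rop (i + 1)) (hT i f)
  rw [map_mul, map_sub, Rop_X_add_one le_rfl,
    Rop_Rop_add_one (PNat.lt_add_right i 1)] at h₁
  rw [map_mul, map_sub, Rop_X_of_lt (PNat.lt_add_right i 1)] at h₂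
  rw [mul_add, h₁, h₂, hT]
  ring
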